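/- arXiv:2508.20819 — 4 statements merged into one kernel-verified Lean document; each statement's English description precedes it below -/
import Mathlib

section
/- For each integer q ≥ 4, there exist a real number c > 1 and infinitely many K_q-divisible graphs G (i.e., for every N there is such a graph on at least N vertices) with minimum degree at least (1 - 1/(c·(q+1)))·v(G) that admit no fractional K_q-decomposition (and hence also no K_q-decomposition). -/
open scoped Classical

/-- A fractional `K_q`-decomposition of `G`: an assignment of non-negative real weights to the
copies of `K_q` (i.e. the `q`-cliques) of `G` such that for every edge of `G`, the total weight
of the `q`-cliques containing that edge is exactly `1`. -/
def SimpleGraph.HasFractionalDecomposition {V : Type*} [Fintype V] (G : SimpleGraph V)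
    (q : ℕ) : Prop :=
  ∃ w : Finset V → ℝ, (∀ s, 0 ≤ w s) ∧
    ∀ ⦃u v : V⦄, G.Adj u v →
      ∑ s ∈ Finset.univ.filter (fun s : Finset V => G.IsNClique q s ∧ u ∈ s ∧ v ∈ s), w s = 1

/-- A `K_q`-decomposition of `G`: a collection of `q`-cliques of `G` whose edge sets partition
the edge set of `G`, i.e. every edge of `G` lies in exactly one clique of the collection. -/
def SimpleGraph.HasCliqueDecomposition {V : Type*} (G : SimpleGraph V) (q : ℕ) : Prop :=
  ∃ D : Finset (Finset V), (∀ s ∈ D, G.IsNClique q s) ∧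
    ∀ ⦃u v : V⦄, G.Adj u v → ∃! s, s ∈ D ∧ u ∈ s ∧ v ∈ s

/-- `G` is `K_q`-divisible: `q.choose 2` divides the number of edges and `q - 1` divides
every vertex degree. -/
def SimpleGraph.KqDivisible {V : Type*} [Fintype V] (G : SimpleGraph V) (q : ℕ) : Prop :=
  q.choose 2 ∣ G.edgeFinset.card ∧ ∀ v : V, (q - 1) ∣ G.degree v

open Finset

namespace SimpleGraph

/-- A clique decomposition gives a fractional one, by indicator weights. -/
theorem HasCliqueDecomposition.hasFractionalDecomposition {V : Type*} [Fintype V]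
    {G : SimpleGraph V} {q : ℕ} (h : G.HasCliqueDecomposition q) :
    G.HasFractionalDecomposition q := by
  obtain ⟨D, hD, hu⟩ := h
  refine ⟨fun s => if s ∈ D then 1 else 0, fun s => by positivity, fun u v huv => ?_⟩
  obtain ⟨s, ⟨hs, hus, hvs⟩, huniq⟩ := hu huv
  rw [Finset.sum_eq_single s]
  · simp [hs]
  · intro r hr hrs
    simp only [mem_filter, mem_univ, true_and] at hr
    exact if_neg fun hrD => hrs (huniq r ⟨hrD, hr.2⟩)
  · intro h_not
    simp [hD s hs, hus, hvs] at h_not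

/-- If the weights `F` on ordered pairs have non-negative sum over each `q`-clique, then they have
non-negative sum over the whole of a graph with a fractional `K_q`-decomposition. -/
theorem HasFractionalDecomposition.sum_nonneg {V : Type*} [Fintype V]
    {G : SimpleGraph V} {q : ℕ} (h : G.HasFractionalDecomposition q) (F : V → V → ℝ)
    (hF : ∀ s, G.IsNClique q s → 0 ≤ ∑ u ∈ s, ∑ v ∈ s, if u = v then 0 else F u v) :
    0 ≤ ∑ u, ∑ v, if G.Adj u v then F u v else 0 := by
  obtain ⟨w, hw, hw1⟩ := h
  have key : ∑ u, ∑ v, (if G.Adj u v then F u v else 0) =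
      ∑ s : Finset V, if G.IsNClique q s then
        w s * ∑ u ∈ s, ∑ v ∈ s, (if u = v then 0 else F u v) else 0 := by
    calc ∑ u, ∑ v, (if G.Adj u v then F u v else 0)
        = ∑ u, ∑ v, ∑ s : Finset V, if G.Adj u v ∧ G.IsNClique q s ∧ u ∈ s ∧ v ∈ s then
            F u v * w s else 0 := by
          refine sum_congr rfl fun u _ => sum_congr rfl fun v _ => ?_
          by_cases huv : G.Adj u v
          · simp only [huv, if_true, true_and]
            rw [← sum_filter, ← mul_sum, hw1 huv, mul_one]
          · simp [huv]
      _ = ∑ s : Finset V, ∑ u, ∑ v, if G.Adj u v ∧ G.IsNClique q s ∧ u ∈ s ∧ v ∈ s then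
            F u v * w s else 0 := by
          rw [sum_comm' (t' := univ) (s' := fun _ => univ) (by simp)]
          rw [sum_congr rfl fun u _ => sum_comm]
          rw [sum_comm]
          rw [sum_congr rfl fun s _ => sum_comm]
      _ = _ := by
          refine sum_congr rfl fun s _ => ?_
          split_ifs with hs
          · rw [mul_sum, ← sum_subset (subset_univ s)]
            · refine sum_congr rfl fun u hu => ?_
              rw [mul_sum, ← sum_subset (subset_univ s)]
              · refine sum_congr rfl fun v hv => ?_
                by_cases huv : u = v
                · simp [huv]
                · simp [hs, hu, hv, huv, hs.isClique hu hv huv, mul_comm]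
              · intro v _ hv
                simp [hv]
            · intro u _ hu
              simp [hu]
          · simp [hs]
  rw [key]
  refine Finset.sum_nonneg fun s _ => ?_
  split_ifs with hs
  · exact mul_nonneg (hw s) (hF s hs)
  · exact le_rfl

/-- A `q`-set meeting `A` in `a` vertices has total weight `q (q - 1) (a - 1) (a - 2)`. -/
theorem sum_sum_offDiag_weight {V : Type*} (s : Finset V) (χ : V → ℝ)
    (hχ : ∀ v, χ v * χ v = χ v) (q : ℝ) (hs : (s.card : ℝ) = q) :
    (∑ u ∈ s, ∑ v ∈ s, if u = v then 0 else q * (q - 1) * (χ u * χ v) - q * (χ u + χ v) + 2) =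
      q * (q - 1) * ((∑ v ∈ s, χ v - 1) * (∑ v ∈ s, χ v - 2)) := by
  set a := ∑ v ∈ s, χ v with ha
  have h1 : ∀ u ∈ s, (∑ v ∈ s, if u = v then 0 else
      q * (q - 1) * (χ u * χ v) - q * (χ u + χ v) + 2) =
      q * (q - 1) * (χ u * a) - q * (q * χ u + a) + q * 2
        - (q * (q - 1) * χ u - q * (χ u + χ u) + 2) := by
    intro u hu
    have : ∀ v, (if u = v then 0 else q * (q - 1) * (χ u * χ v) - q * (χ u + χ v) + 2) =
        (q * (q - 1) * (χ u * χ v) - q * (χ u + χ v) + 2) -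
        (if u = v then q * (q - 1) * (χ u * χ u) - q * (χ u + χ u) + 2 else 0) := by
      intro v
      split_ifs with h
      · subst h; ring
      · ring
    simp only [this, sum_sub_distrib, sum_add_distrib, sum_ite_eq, hu, if_true, ← mul_sum,
      sum_const, nsmul_eq_mul, hs, hχ, ha]
  rw [sum_congr rfl h1]
  simp only [sum_sub_distrib, sum_add_distrib, ← mul_sum, ← sum_mul, sum_const, nsmul_eq_mul, hs,
    ← ha]
  ring

/-- A vertex set `A` spanning few edges compared with the degrees of its vertices obstructs
fractional `K_q`-decompositions. -/
theorem not_hasFractionalDecomposition_of_sum_neg {V : Type*} [Fintype V]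
    (G : SimpleGraph V) (q : ℕ) (hq : 1 ≤ q) (A : V → Prop)
    (hneg : (∑ u, ∑ v, if G.Adj u v then
      ((q : ℝ) * (q - 1) * ((if A u then 1 else 0) * (if A v then 1 else 0)) -
        q * ((if A u then 1 else 0) + (if A v then 1 else 0)) + 2) else 0) < 0) :
    ¬ G.HasFractionalDecomposition q := by
  intro h
  refine absurd (h.sum_nonneg _ fun s hs => ?_) (not_le.mpr hneg)
  have hq' : (1 : ℝ) ≤ q := by exact_mod_cast hq
  rw [sum_sum_offDiag_weight s (fun v => if A v then 1 else 0) (by intro v; simp) q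
    (by rw [hs.card_eq])]
  refine mul_nonneg (mul_nonneg (by linarith) (by linarith)) ?_
  rw [sum_boole]
  generalize (s.filter A).card = a
  rcases a with _ | _ | a
  · norm_num
  · norm_num
  · push_cast
    nlinarith [(Nat.cast_nonneg a : (0 : ℝ) ≤ a)]

end SimpleGraph

/-- The indices of the blobs: `Bool × Fin 20` for the blobs of `A`, the others for those of `B`. -/
abbrev Blob (q : ℕ) : Type := (Bool × Fin 20) ⊕ Option (Fin (q - 1))

/-- The relative size of a blob. -/
def blobSize (q : ℕ) : Blob q → ℕ
  | .inl _ => 10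
  | .inr none => 21
  | .inr (some _) => 210

/-- The graph of blobs: `K_{20,20}` minus a perfect matching, joined to a `K_q`. -/
def blobGraph (q : ℕ) : SimpleGraph (Blob q) where
  Adj
    | .inl a, .inl b => a.1 ≠ b.1 ∧ a.2 ≠ b.2
    | .inr a, .inr b => a ≠ b
    | _, _ => True
  symm := ⟨by
    rintro (a | a) (b | b) h
    · exact ⟨h.1.symm, h.2.symm⟩
    · trivial
    · trivial
    · exact Ne.symm h⟩
  loopless := ⟨by
    rintro (a | a) h
    · exact h.1 rfl
    · exact h rfl⟩

/-- The relative degree of the vertices of a blob. -/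
def blobDegree (q : ℕ) : Blob q → ℕ
  | .inr none => 210 * q + 190
  | _ => 210 * q + 1

theorem exists_fin_map_card_fiber {β : Type*} [Fintype β] (w : β → ℕ) :
    ∃ (n : ℕ) (p : Fin n → β), n = ∑ b, w b ∧ ∀ b, (univ.filter fun v => p v = b).card = w b := by
  let e : Fin (∑ b, w b) ≃ Σ b, Fin (w b) := (Fintype.equivFinOfCardEq (by simp)).symm
  refine ⟨_, fun v => (e v).1, rfl, fun b => ?_⟩
  calc (univ.filter fun v => (e v).1 = b).card
      = ∑ v, if (e v).1 = b then 1 else 0 := by rw [card_filter]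
    _ = ∑ x : Σ b, Fin (w b), if x.1 = b then 1 else 0 :=
        e.sum_comp (fun x => if x.1 = b then 1 else 0)
    _ = w b := by
        rw [Fintype.sum_sigma, Fintype.sum_eq_single b fun a ha => by simp [ha]]
        simp

theorem sum_comp_of_card_fiber {α β M : Type*} [Fintype α] [Fintype β] [AddCommMonoid M]
    {w : β → ℕ} {p : α → β} (hp : ∀ b, (univ.filter fun v => p v = b).card = w b) (F : β → M) :
    ∑ v, F (p v) = ∑ b, w b • F b := by
  rw [← Finset.sum_fiberwise univ p]
  refine sum_congr rfl fun b _ => ?_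
  rw [← hp b, ← sum_const]
  refine sum_congr rfl fun v hv => ?_
  rw [(mem_filter.mp hv).2]

theorem sum_blobSize (q : ℕ) (hq : 4 ≤ q) : ∑ b, blobSize q b = 210 * q + 211 := by
  simp [blobSize, Fintype.sum_sum_type, Fintype.sum_option]
  omega

theorem sum_blobSize_adj (q : ℕ) (hq : 4 ≤ q) (a : Blob q) :
    (∑ b, if (blobGraph q).Adj a b then blobSize q b else 0) = blobDegree q a := by
  obtain ⟨k, rfl⟩ : ∃ k, q = k + 2 := ⟨q - 2, by omega⟩
  rcases a with ⟨a, i⟩ | (_ | a)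
  · have : ∑ j : Fin 20, (if i = j then 0 else 10) = 190 := by
      revert i; decide
    cases a <;>
    simp [blobGraph, blobSize, blobDegree, Fintype.sum_sum_type, Fintype.sum_option,
      Fintype.sum_prod_type, ite_not, this] <;> omega
  · simp [blobGraph, blobSize, blobDegree, Fintype.sum_sum_type, Fintype.sum_option]
    omega
  · have : ∑ b : Fin (k + 1), (if a = b then 0 else 210) = 210 * k := by
      simp_rw [← ite_not (p := a = _) 210 0]
      rw [← sum_filter, sum_const, filter_ne, card_erase_of_mem (mem_univ a)]
      simp [mul_comm]
    simp [blobGraph, blobSize, blobDegree, Fintype.sum_sum_type, Fintype.sum_option, ite_not, this]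
    omega

theorem sum_blobSize_adj_isLeft (q : ℕ) (a : Blob q) :
    (∑ b, if (blobGraph q).Adj a b ∧ b.isLeft then blobSize q b else 0) =
      if a.isLeft then 190 else 400 := by
  rcases a with ⟨a, i⟩ | a
  · have : ∑ j : Fin 20, (if i = j then 0 else 10) = 190 := by
      revert i; decide
    cases a <;> simp [blobGraph, blobSize, Fintype.sum_sum_type, Fintype.sum_prod_type, ite_not, this]
  · simp [blobGraph, blobSize, Fintype.sum_sum_type]

theorem sum_blob_weight_neg (q : ℕ) (hq : 4 ≤ q) :
    (∑ a : Blob q, (blobSize q a : ℝ) * ∑ b : Blob q, (blobSize q b : ℝ) *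
      if (blobGraph q).Adj a b then
      ((q : ℝ) * (q - 1) * ((if a.isLeft then 1 else 0) * (if b.isLeft then 1 else 0)) -
        q * ((if a.isLeft then 1 else 0) + (if b.isLeft then 1 else 0)) + 2) else 0) < 0 := by
  have inner : ∀ a : Blob q, (∑ b : Blob q, (blobSize q b : ℝ) *
      if (blobGraph q).Adj a b then
      ((q : ℝ) * (q - 1) * ((if a.isLeft then 1 else 0) * (if b.isLeft then 1 else 0)) -
        q * ((if a.isLeft then 1 else 0) + (if b.isLeft then 1 else 0)) + 2) else 0) =
      (q * (q - 1) * (if a.isLeft then 1 else 0) - q) * (if a.isLeft then 190 else 400) +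
        (2 - q * (if a.isLeft then 1 else 0)) * blobDegree q a := by
    intro a
    have h1 : (∑ b, if (blobGraph q).Adj a b then (blobSize q b : ℝ) else 0) = blobDegree q a := by
      exact_mod_cast congrArg (Nat.cast (R := ℝ)) (sum_blobSize_adj q hq a)
    have h2 : (∑ b, if (blobGraph q).Adj a b ∧ b.isLeft then (blobSize q b : ℝ) else 0) =
        if a.isLeft then 190 else 400 := by
      exact_mod_cast congrArg (Nat.cast (R := ℝ)) (sum_blobSize_adj_isLeft q a)
    rw [← h1, ← h2, mul_sum, mul_sum, ← sum_add_distrib]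
    refine sum_congr rfl fun b _ => ?_
    by_cases hab : (blobGraph q).Adj a b <;> by_cases hb : b.isLeft = true <;>
      by_cases ha : a.isLeft = true <;> simp [hab, hb, ha] <;> ring
  simp only [inner]
  have hq1 : ((q - 1 : ℕ) : ℝ) = q - 1 := by
    rw [Nat.cast_sub (by omega), Nat.cast_one]
  have hq0 : (4 : ℝ) ≤ q := by exact_mod_cast hq
  simp [blobSize, blobDegree, Fintype.sum_sum_type, Fintype.sum_option, hq1]
  nlinarith

/-- For each integer `q ≥ 4`, there exist a real `c > 1` and infinitely many `K_q`-divisible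
graphs `G` (for every `N` one on at least `N` vertices) with minimum degree at least
`(1 - 1/(c·(q+1)))·v(G)` admitting no fractional `K_q`-decomposition (hence no
`K_q`-decomposition). -/
theorem statement0 (q : ℕ) (hq : 4 ≤ q) :
    ∃ c : ℝ, 1 < c ∧
      ∀ N : ℕ, ∃ (n : ℕ) (G : SimpleGraph (Fin n)),
        N ≤ n ∧ G.KqDivisible q ∧
        (1 - 1 / (c * (q + 1))) * n ≤ (G.minDegree : ℝ) ∧
        ¬ G.HasFractionalDecomposition q ∧ ¬ G.HasCliqueDecomposition q := by
  have hq0 : (4 : ℝ) ≤ q := by exact_mod_cast hq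
  refine ⟨1 + 1 / (210 * (q + 1)), by simp; positivity, fun N => ?_⟩
  obtain ⟨t, ht⟩ : ∃ t, t = q * (q - 1) * (N + 1) := ⟨_, rfl⟩
  have ht0 : 0 < t := by
    have h1 : 0 < q - 1 := by omega
    rw [ht]
    positivity
  have htN : N ≤ t := by
    have : 1 ≤ q * (q - 1) := Nat.mul_pos (by omega) (by omega)
    nlinarith
  obtain ⟨n, p, hn, hp⟩ := exists_fin_map_card_fiber fun b => t * blobSize q b
  rw [← mul_sum, sum_blobSize q hq] at hn
  obtain ⟨G, hG⟩ : ∃ G : SimpleGraph (Fin n), ∀ u v, G.Adj u v ↔ (blobGraph q).Adj (p u) (p v) :=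
    ⟨(blobGraph q).comap p, fun _ _ => Iff.rfl⟩
  have hdeg : ∀ v, G.degree v = t * blobDegree q (p v) := by
    intro v
    rw [← SimpleGraph.card_neighborFinset_eq_degree, SimpleGraph.neighborFinset_eq_filter,
      card_filter, ← sum_blobSize_adj q hq]
    simp only [hG]
    refine (sum_comp_of_card_fiber hp
      (fun b => if (blobGraph q).Adj (p v) b then 1 else 0)).trans ?_
    rw [mul_sum]
    refine sum_congr rfl fun b _ => ?_
    split_ifs <;> simp
  have hfrac : ¬ G.HasFractionalDecomposition q := by
    refine G.not_hasFractionalDecomposition_of_sum_neg q (by omega) (fun v => (p v).isLeft) ?_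
    refine lt_of_eq_of_lt ?_ (mul_neg_of_pos_of_neg (pow_pos (Nat.cast_pos.mpr ht0) 2)
      (sum_blob_weight_neg q hq))
    let F : Blob q → Blob q → ℝ := fun a b => if (blobGraph q).Adj a b then
      ((q : ℝ) * (q - 1) * ((if a.isLeft then 1 else 0) * (if b.isLeft then 1 else 0)) -
        q * ((if a.isLeft then 1 else 0) + (if b.isLeft then 1 else 0)) + 2) else 0
    calc _ = ∑ u, ∑ v, F (p u) (p v) := by simp only [hG, F]; congr!
      _ = ∑ u, ∑ b, (t * blobSize q b) • F (p u) b :=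
        sum_congr rfl fun u _ => sum_comp_of_card_fiber hp (F (p u))
      _ = ∑ a, (t * blobSize q a) • ∑ b, (t * blobSize q b) • F a b :=
        sum_comp_of_card_fiber hp fun a => ∑ b, (t * blobSize q b) • F a b
      _ = (t : ℝ) ^ 2 * ∑ a, (blobSize q a : ℝ) * ∑ b, (blobSize q b : ℝ) * F a b := by
        simp only [mul_sum, nsmul_eq_mul, Nat.cast_mul]
        exact sum_congr rfl fun a _ => sum_congr rfl fun b _ => by ring
  refine ⟨n, G, ?_, ⟨?_, fun v => ?_⟩, ?_, hfrac, fun h => hfrac h.hasFractionalDecomposition⟩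
  · rw [hn]; nlinarith
  · have hsum := G.sum_degrees_eq_twice_card_edges
    simp only [hdeg] at hsum
    rw [sum_comp_of_card_fiber hp (fun b => t * blobDegree q b)] at hsum
    have : ∑ b, (t * blobSize q b) • (t * blobDegree q b) =
        t * (t * ∑ b, blobSize q b * blobDegree q b) := by
      simp only [mul_sum, smul_eq_mul]
      exact sum_congr rfl fun b _ => by ring
    rw [this] at hsum
    have h2 : q.choose 2 * 2 = q * (q - 1) := by
      rw [Nat.choose_two_right]
      exact Nat.div_mul_cancel (Nat.even_mul_pred_self q).two_dvd
    refine ⟨(N + 1) * (t * ∑ b, blobSize q b * blobDegree q b), ?_⟩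
    have : t = q.choose 2 * 2 * (N + 1) := by rw [h2, ht]
    refine Nat.eq_of_mul_eq_mul_left two_pos ?_
    refine Eq.trans ?_ (hsum.symm.trans ?_)
    · congr!
    · nth_rewrite 1 [this]
      ring
  · rw [hdeg]
    exact Dvd.dvd.mul_right ⟨q * (N + 1), by rw [ht]; ring⟩ _
  · have : Nonempty (Fin n) := ⟨⟨0, by rw [hn]; positivity⟩⟩
    have hmin : t * (210 * q + 1) ≤ G.minDegree := by
      refine G.le_minDegree_of_forall_le_degree _ fun v => ?_
      rw [hdeg]
      refine Nat.mul_le_mul_left _ ?_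
      rcases p v with _ | _ | _ <;> simp [blobDegree]
    have hmin' : (t : ℝ) * (210 * q + 1) ≤ G.minDegree := by exact_mod_cast hmin
    refine le_trans (le_of_eq ?_) hmin'
    rw [hn]
    push_cast
    field_simp
    ring
end

section
/- For every integer q ≥ 4, there exist a real number c > 1 and infinitely many balanced partite-K_q-divisible q-partite graphs G (i.e., for every N there is such a graph on at least N vertices) with partite minimum degree δ̂(G) ≥ (1 - 1/(c·(q+1)))·v(G)/q that admit no fractional K_q-decomposition (and hence also no K_q-decomposition). -/
open scoped Classical

/-- The number of neighbours of the vertex `a` lying in the part `{j} × Fin n` of the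
balanced `q`-partite graph `G` on `Fin q × Fin n`. -/
noncomputable def partDeg {q n : ℕ} (G : SimpleGraph (Fin q × Fin n))
    (a : Fin q × Fin n) (j : Fin q) : ℕ :=
  (Finset.univ.filter (fun b : Fin q × Fin n => b.1 = j ∧ G.Adj a b)).card

open Finset in
/-- A linear-programming dual certificate against fractional `K_q`-decompositions: edge weights
which are non-negative on each `q`-clique but have negative total. -/
theorem SimpleGraph.not_hasFractionalDecomposition_of_weight {V : Type*} [Fintype V]
    (G : SimpleGraph V) (q : ℕ) (F : V → V → ℝ)
    (hclique : ∀ s : Finset V, G.IsNClique q s →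
      0 ≤ ∑ a ∈ s, ∑ b ∈ s, if G.Adj a b then F a b else 0)
    (htotal : ∑ a, ∑ b, (if G.Adj a b then F a b else 0) < 0) :
    ¬ G.HasFractionalDecomposition q := by
  rintro ⟨w, hw, hsum⟩
  refine absurd htotal (not_lt.mpr ?_)
  have key : ∑ a, ∑ b, (if G.Adj a b then F a b else 0) =
      ∑ s ∈ univ.filter (fun s : Finset V => G.IsNClique q s),
        w s * ∑ a ∈ s, ∑ b ∈ s, if G.Adj a b then F a b else 0 := by
    have h1 : ∀ a b, (if G.Adj a b then F a b else 0) =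
        ∑ s ∈ univ.filter (fun s : Finset V => G.IsNClique q s),
          if a ∈ s then if b ∈ s then w s * (if G.Adj a b then F a b else 0) else 0 else 0 := by
      intro a b
      by_cases hab : G.Adj a b
      · simp only [hab, if_true]
        conv_lhs => rw [← one_mul (F a b), ← hsum hab, sum_mul]
        rw [sum_filter, sum_filter]
        refine sum_congr rfl fun s _ => ?_
        by_cases h1 : G.IsNClique q s <;> by_cases h2 : a ∈ s <;> by_cases h3 : b ∈ s <;>
          simp [h1, h2, h3]
      · simp [hab]
    rw [sum_congr rfl fun a _ => (sum_congr rfl fun b _ => h1 a b).trans sum_comm, sum_comm]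
    refine sum_congr rfl fun s _ => ?_
    have hs : ∀ g : V → ℝ, ∑ a ∈ s, g a = ∑ a, if a ∈ s then g a else 0 := fun g => by simp
    simp_rw [hs, mul_sum]
    refine sum_congr rfl fun a _ => ?_
    by_cases ha : a ∈ s <;> simp [ha, mul_sum]
  rw [key]
  exact sum_nonneg fun s hs => mul_nonneg (hw s) (hclique s (mem_filter.mp hs).2)

open Finset in
theorem SimpleGraph.HasCliqueDecomposition.hasFractionalDecomposition_s2 {V : Type*} [Fintype V]
    {G : SimpleGraph V} {q : ℕ} (h : G.HasCliqueDecomposition q) :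
    G.HasFractionalDecomposition q := by
  obtain ⟨D, hD, hex⟩ := h
  refine ⟨fun s => if s ∈ D then 1 else 0, fun s => by positivity, fun u v huv => ?_⟩
  obtain ⟨s, ⟨hsD, hus, hvs⟩, huniq⟩ := hex huv
  rw [sum_eq_single_of_mem s (by simp [hD s hsD, hus, hvs]), if_pos hsD]
  intro t ht hts
  rw [mem_filter] at ht
  exact if_neg fun htD => hts (huniq t ⟨htD, ht.2.2⟩)

/-- The relation on `A ⊕ B` relating everything across, and `x, y` on the same side unless
their sum lies in the forbidden set `S` (respectively `T`). -/
def sumRel {A B : Type*} [Add A] [Add B] (S : Finset A) (T : Finset B) : A ⊕ B → A ⊕ B → Prop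
  | .inl x, .inl y => x + y ∉ S
  | .inr x, .inr y => x + y ∉ T
  | _, _ => True

theorem sumRel_symm {A B : Type*} [AddCommGroup A] [AddCommGroup B] {S : Finset A}
    {T : Finset B} {x y : A ⊕ B} (h : sumRel S T x y) : sumRel S T y x := by
  rcases x with x | x <;> rcases y with y | y <;> simp_all [sumRel, add_comm]

theorem ite_sumRel_inl {A B C : Type*} [Add A] [Add B] (S : Finset A) (T : Finset B) (x y : A)
    (c d : C) : (if sumRel S T (.inl x) (.inl y) then c else d) = if x + y ∉ S then c else d :=
  if_congr Iff.rfl rfl rfl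

theorem ite_sumRel_inr {A B C : Type*} [Add A] [Add B] (S : Finset A) (T : Finset B) (x y : B)
    (c d : C) : (if sumRel S T (.inr x) (.inr y) then c else d) = if x + y ∉ T then c else d :=
  if_congr Iff.rfl rfl rfl

theorem sumRel_inl_inr {A B : Type*} [Add A] [Add B] (S : Finset A) (T : Finset B) (x : A)
    (y : B) : sumRel S T (.inl x) (.inr y) := trivial

theorem sumRel_inr_inl {A B : Type*} [Add A] [Add B] (S : Finset A) (T : Finset B) (x : B)
    (y : A) : sumRel S T (.inr x) (.inl y) := trivial

open Finset in
theorem card_filter_add_notMem {A : Type*} [AddCommGroup A] [Fintype A] (S : Finset A) (x : A) :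
    (univ.filter fun y => x + y ∉ S).card = Fintype.card A - S.card := by
  rw [← card_compl]
  refine card_bij (fun y _ => x + y) (by simp) (by simp) fun b hb => ⟨-x + b, ?_, by simp⟩
  simpa using hb

open Finset in
theorem card_sumRel_inl {A B : Type*} [AddCommGroup A] [AddCommGroup B] [Fintype A] [Fintype B]
    (S : Finset A) (T : Finset B) (x : A) :
    (univ.filter fun y => sumRel S T (.inl x) y).card =
      Fintype.card A - S.card + Fintype.card B := by
  rw [← card_filter_add_notMem S x, card_filter, card_filter, Fintype.sum_sum_type]
  simp_rw [ite_sumRel_inl, if_pos (sumRel_inl_inr S T x _)]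
  simp

open Finset in
theorem card_sumRel_inr {A B : Type*} [AddCommGroup A] [AddCommGroup B] [Fintype A] [Fintype B]
    (S : Finset A) (T : Finset B) (x : B) :
    (univ.filter fun y => sumRel S T (.inr x) y).card =
      Fintype.card B - T.card + Fintype.card A := by
  rw [← card_filter_add_notMem T x, card_filter, card_filter, Fintype.sum_sum_type,
    add_comm]
  simp_rw [ite_sumRel_inr, if_pos (sumRel_inr_inl S T x _)]
  simp

/-- The tensor product of `K_q` with a symmetric relation `R` (possibly with loops) on `X`,
where `X` is enumerated by `Fin n`. -/
def tensorGraph {X : Type*} (q : ℕ) {n : ℕ} (e : Fin n ≃ X) (R : X → X → Prop)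
    (hR : ∀ {x y}, R x y → R y x) : SimpleGraph (Fin q × Fin n) where
  Adj a b := a.1 ≠ b.1 ∧ R (e a.2) (e b.2)
  symm := ⟨fun _ _ h => ⟨h.1.symm, hR h.2⟩⟩
  loopless := ⟨fun _ h => h.1 rfl⟩

open Finset in
theorem partDeg_tensorGraph {X : Type*} [Fintype X] {q n : ℕ} (e : Fin n ≃ X)
    (R : X → X → Prop) (hR : ∀ {x y}, R x y → R y x) (a : Fin q × Fin n) (j : Fin q)
    (hj : j ≠ a.1) :
    partDeg (tensorGraph q e R hR) a j = (univ.filter fun y => R (e a.2) y).card := by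
  unfold partDeg
  refine card_bij (fun b _ => e b.2) (fun b hb => ?_) (fun b hb b' hb' h => ?_) fun y hy => ?_
  · simp only [mem_filter, mem_univ, true_and] at hb ⊢
    exact hb.2.2
  · simp only [mem_filter, mem_univ, true_and] at hb hb'
    exact Prod.ext (hb.1.trans hb'.1.symm) (e.injective h)
  · simp only [mem_filter, mem_univ, true_and] at hy
    exact ⟨(j, e.symm y), mem_filter.mpr ⟨mem_univ _, rfl, hj.symm, by simpa using hy⟩, by simp⟩

open Finset in
theorem sum_tensorGraph {X : Type*} [Fintype X] {q n : ℕ} (e : Fin n ≃ X)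
    (R : X → X → Prop) (hR : ∀ {x y}, R x y → R y x) (f : X → X → ℝ) :
    ∑ a, ∑ b, (if (tensorGraph q e R hR).Adj a b then f (e a.2) (e b.2) else 0) =
      q * (q - 1) * ∑ x, ∑ y, if R x y then f x y else 0 := by
  have h : ∀ a b : Fin q × Fin n,
      (if (tensorGraph q e R hR).Adj a b then f (e a.2) (e b.2) else 0) =
        (if a.1 ≠ b.1 then 1 else 0) *
          (if R (e a.2) (e b.2) then f (e a.2) (e b.2) else 0) := by
    intro a b
    by_cases h1 : a.1 = b.1 <;> simp [tensorGraph, h1]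
  have hq : ∑ i : Fin q, ∑ j : Fin q, (if i ≠ j then (1 : ℝ) else 0) = q * (q - 1) := by
    have : ∀ i j : Fin q, (if i ≠ j then (1 : ℝ) else 0) = 1 - if i = j then 1 else 0 := by
      intro i j
      by_cases h : i = j <;> simp [h]
    simp [this, mul_sub]
  rw [← hq, ← Equiv.sum_comp e]
  simp_rw [h, ← Equiv.sum_comp e (fun y => if R _ y then f _ y else 0), Fintype.sum_prod_type,
    sum_mul, mul_sum]
  refine sum_congr rfl fun i _ => ?_
  rw [sum_comm]

/-- The dual weight on pairs of points of `A ⊕ B`, depending only on the sides they lie in. -/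
noncomputable def sideWeight {A B : Type*} (q : ℝ) : A ⊕ B → A ⊕ B → ℝ
  | .inl _, .inl _ => (q - 1) * (q - 2)
  | .inr _, .inr _ => 2
  | _, _ => -(q - 2)

open Finset in
theorem sum_sideWeight {V A B : Type*} (s : Finset V) (g : V → A ⊕ B) (q : ℝ)
    (hq : (s.card : ℝ) = q) :
    0 ≤ ∑ a ∈ s, ∑ b ∈ s, if a ≠ b then sideWeight q (g a) (g b) else 0 := by
  set u : V → ℝ := fun a => if (g a).isLeft then 1 else 0 with hu
  have hF : ∀ a b, sideWeight q (g a) (g b) =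
      q * (q - 1) * (u a * u b) - q * u a - q * u b + 2 := by
    intro a b
    rcases ha : g a with x | x <;> rcases hb : g b with y | y <;>
      simp [hu, ha, hb, sideWeight] <;> ring
  have hdiag : ∀ a b, (if a ≠ b then sideWeight q (g a) (g b) else 0) =
      sideWeight q (g a) (g b) -
        if a = b then (q * (q - 1) - 2 * q) * u a + 2 else 0 := by
    intro a b
    by_cases hab : a = b
    · subst hab
      have : u a * u a = u a := by by_cases h : (g a).isLeft <;> simp [hu, h]
      simp only [ne_eq, not_true_eq_false, if_false, if_true, hF, this]
      ring
    · simp [hab]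
  obtain ⟨i, hi⟩ : ∃ i : ℕ, ∑ a ∈ s, u a = i := ⟨_, by simp [hu]; rfl⟩
  have hval : ∑ a ∈ s, ∑ b ∈ s, (if a ≠ b then sideWeight q (g a) (g b) else 0) =
      q * (q - 1) * ((i - 1) * (i - 2)) := by
    have h1 : ∑ a ∈ s, ∑ b ∈ s, sideWeight q (g a) (g b) =
        q * (q - 1) * (i * i) - q * (q * i) - q * (q * i) + 2 * (q * q) := by
      simp only [hF, sum_add_distrib, sum_sub_distrib, ← mul_sum, ← sum_mul, hi, sum_const,
        nsmul_eq_mul, hq]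
      ring
    have h2 : ∑ a ∈ s, ∑ b ∈ s, (if a = b then (q * (q - 1) - 2 * q) * u a + 2 else 0) =
        (q * (q - 1) - 2 * q) * i + 2 * q := by
      rw [sum_congr rfl fun a ha => (sum_ite_eq s a _).trans (if_pos ha)]
      simp only [sum_add_distrib, ← mul_sum, hi, sum_const, nsmul_eq_mul, hq]
      ring
    simp_rw [hdiag, sum_sub_distrib]
    rw [h1, h2]
    ring
  rw [hval, ← hq]
  have hi' : (0 : ℝ) ≤ ((i : ℝ) - 1) * (i - 2) := by
    rcases i with _ | _ | i
    · norm_num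
    · norm_num
    · push_cast
      have : (0 : ℝ) ≤ i := i.cast_nonneg
      nlinarith
  refine mul_nonneg ?_ hi'
  rcases s.card with _ | k
  · simp
  · push_cast
    nlinarith [(k.cast_nonneg : (0 : ℝ) ≤ k)]

open Finset in
theorem sum_sumRel_sideWeight {A B : Type*} [AddCommGroup A] [AddCommGroup B] [Fintype A]
    [Fintype B] (S : Finset A) (T : Finset B) (q : ℝ) :
    ∑ x, ∑ y, (if sumRel S T x y then sideWeight q x y else 0) =
      Fintype.card A * ((Fintype.card A - S.card : ℝ) * ((q - 1) * (q - 2))) +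
      Fintype.card B * ((Fintype.card B - T.card : ℝ) * 2) -
      2 * (q - 2) * (Fintype.card A * Fintype.card B) := by
  have hA : ∀ x : A, ∑ y, (if x + y ∉ S then (q - 1) * (q - 2) else 0) =
      (Fintype.card A - S.card : ℝ) * ((q - 1) * (q - 2)) := fun x => by
    rw [← sum_filter, sum_const, card_filter_add_notMem, nsmul_eq_mul,
      Nat.cast_sub (card_le_univ S)]
  have hB : ∀ x : B, ∑ y, (if x + y ∉ T then (2 : ℝ) else 0) =
      (Fintype.card B - T.card : ℝ) * 2 := fun x => by
    rw [← sum_filter, sum_const, card_filter_add_notMem, nsmul_eq_mul,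
      Nat.cast_sub (card_le_univ T)]
  simp only [Fintype.sum_sum_type, ite_sumRel_inl, ite_sumRel_inr, sumRel_inl_inr,
    sumRel_inr_inl, sideWeight, hA, hB, if_true, sum_add_distrib, sum_const, card_univ,
    nsmul_eq_mul]
  ring

/-- For every integer `q ≥ 4`, there exist a real `c > 1` and infinitely many balanced
partite-`K_q`-divisible `q`-partite graphs `G` (with parts `{i} × Fin n`, on at least `N`
vertices for every `N`) with partite minimum degree at least `(1 - 1/(c·(q+1)))·v(G)/q`
admitting no fractional `K_q`-decomposition (hence no `K_q`-decomposition). -/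
theorem statement2 (q : ℕ) (hq : 4 ≤ q) :
    ∃ c : ℝ, 1 < c ∧
      ∀ N : ℕ, ∃ (n : ℕ) (G : SimpleGraph (Fin q × Fin n)),
        N ≤ q * n ∧
        (∀ a b : Fin q × Fin n, G.Adj a b → a.1 ≠ b.1) ∧
        (∀ (a : Fin q × Fin n) (j₁ j₂ : Fin q), j₁ ≠ a.1 → j₂ ≠ a.1 →
          partDeg G a j₁ = partDeg G a j₂) ∧
        (∀ (a : Fin q × Fin n) (j : Fin q), j ≠ a.1 →
          (1 - 1 / (c * (q + 1))) * n ≤ (partDeg G a j : ℝ)) ∧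
        ¬ G.HasFractionalDecomposition q ∧ ¬ G.HasCliqueDecomposition q := by
  have hq4 : (4 : ℝ) ≤ q := by exact_mod_cast hq
  refine ⟨(12 * q + 13) / (12 * q + 12), by rw [lt_div_iff₀ (by positivity)]; linarith,
    fun N => ?_⟩
  obtain ⟨r, rfl⟩ : ∃ r, q = r + 4 := ⟨q - 4, by omega⟩
  set M := N + 1 with hM
  have : NeZero (22 * M) := ⟨by omega⟩
  have : NeZero ((12 * r + 39) * M) := ⟨by positivity⟩
  obtain ⟨S, -, hS⟩ := Finset.exists_subset_card_eq
    (s := (Finset.univ : Finset (ZMod (22 * M)))) (n := 12 * M) (by simp [ZMod.card]; omega)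
  obtain ⟨T, -, hT⟩ := Finset.exists_subset_card_eq
    (s := (Finset.univ : Finset (ZMod ((12 * r + 39) * M)))) (n := 12 * M)
    (by simp only [Finset.card_univ, ZMod.card]; exact Nat.mul_le_mul_right _ (by omega))
  let e : Fin ((12 * r + 61) * M) ≃ ZMod (22 * M) ⊕ ZMod ((12 * r + 39) * M) :=
    (Fintype.equivFinOfCardEq (by
      rw [Fintype.card_sum, ZMod.card, ZMod.card]; ring)).symm
  let R := sumRel S T
  let G := tensorGraph (r + 4) e R sumRel_symm
  have hfrac : ¬ G.HasFractionalDecomposition (r + 4) := by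
    refine G.not_hasFractionalDecomposition_of_weight _
      (fun a b => sideWeight ((r + 4 : ℕ) : ℝ) (e a.2) (e b.2)) (fun s hs => ?_) ?_
    · refine (sum_sideWeight s (fun a => e a.2) _ (by rw [hs.card_eq])).trans_eq ?_
      refine Finset.sum_congr rfl fun a ha => Finset.sum_congr rfl fun b hb => ?_
      have : a ≠ b ↔ G.Adj a b := ⟨fun h => hs.isClique ha hb h, fun h => h.ne⟩
      simp only [this]
    · rw [sum_tensorGraph, sum_sumRel_sideWeight, ZMod.card, ZMod.card, hS, hT]
      have hM0 : (0 : ℝ) < M := by positivity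
      have hr : (0 : ℝ) ≤ r := r.cast_nonneg
      push_cast
      refine mul_neg_of_pos_of_neg (by nlinarith) ?_
      have : (M : ℝ) ^ 2 * (20 * r ^ 2 + 88 * r + 6) > 0 := by positivity
      linarith
  have hdeg : ∀ (a : Fin (r + 4) × Fin ((12 * r + 61) * M)) (j : Fin (r + 4)), j ≠ a.1 →
      partDeg G a j = (12 * r + 49) * M := by
    intro a j hj
    rw [partDeg_tensorGraph e R _ a j hj]
    have hX : ∀ x, (Finset.univ.filter fun y => R x y).card = (12 * r + 49) * M := by
      rintro (x | x)
      · rw [card_sumRel_inl, ZMod.card, ZMod.card, hS, ← Nat.sub_mul, ← add_mul]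
        congr 1
        omega
      · rw [card_sumRel_inr, ZMod.card, ZMod.card, hT, ← Nat.sub_mul, ← add_mul]
        congr 1
    exact hX _
  refine ⟨(12 * r + 61) * M, G, ?_, fun a b h => h.1, fun a j₁ j₂ h₁ h₂ => ?_,
    fun a j hj => ?_, hfrac, fun h => hfrac h.hasFractionalDecomposition_s2⟩
  · calc N ≤ M := N.le_succ
      _ ≤ (r + 4) * (12 * r + 61) * M := Nat.le_mul_of_pos_left _ (by positivity)
      _ = _ := mul_assoc _ _ _
  · rw [hdeg a j₁ h₁, hdeg a j₂ h₂]
  · rw [hdeg a j hj]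
    push_cast
    apply le_of_eq
    field_simp
    ring
end

section
/- For every integer q ≥ 2, every integer m ≥ 1, and every finite simple graph G, the m-blowup G∘K̄_m admits a fractional K_q-decomposition if and only if G admits a fractional K_q-decomposition. -/
open scoped Classical

/-- The `m`-blowup `G ∘ K̄_m` of `G`: vertex set `V × Fin m`, with `(v₁, v₂)` adjacent to
`(u₁, u₂)` if and only if `v₁` is adjacent to `u₁` in `G`. -/
def SimpleGraph.blowup {V : Type*} (G : SimpleGraph V) (m : ℕ) : SimpleGraph (V × Fin m) :=
  SimpleGraph.comap Prod.fst G

/-- A finite weighted family of `q`-cliques, possibly with repetitions, that covers every edge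
with total weight `1` yields a fractional `K_q`-decomposition. -/
theorem SimpleGraph.HasFractionalDecomposition.of_family {V ι : Type*} [Fintype V]
    {G : SimpleGraph V} {q : ℕ} (I : Finset ι) (K : ι → Finset V) (c : ι → ℝ)
    (hc : ∀ i ∈ I, 0 ≤ c i) (hK : ∀ i ∈ I, G.IsNClique q (K i))
    (h : ∀ ⦃u v : V⦄, G.Adj u v → ∑ i ∈ I with u ∈ K i ∧ v ∈ K i, c i = 1) :
    G.HasFractionalDecomposition q := by
  refine ⟨fun s => ∑ i ∈ I with K i = s, c i,
    fun s => Finset.sum_nonneg fun i hi => hc i (Finset.mem_filter.mp hi).1, fun u v huv => ?_⟩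
  rw [← h huv, ← Finset.sum_fiberwise_of_maps_to (g := K)
    (t := Finset.univ.filter fun s : Finset V => G.IsNClique q s ∧ u ∈ s ∧ v ∈ s)]
  · refine Finset.sum_congr rfl fun s hs => Finset.sum_congr ?_ fun _ _ => rfl
    ext i
    simp only [Finset.mem_filter, Finset.mem_univ, true_and] at hs ⊢
    constructor
    · rintro ⟨hi, rfl⟩
      exact ⟨⟨hi, hs.2⟩, rfl⟩
    · rintro ⟨⟨hi, -⟩, rfl⟩
      exact ⟨hi, rfl⟩
  · intro i hi
    rw [Finset.mem_filter] at hi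
    simpa using ⟨hK i hi.1, hi.2⟩

/-- A clique of the blowup meets every fibre of the projection in at most one vertex. -/
theorem SimpleGraph.IsClique.injOn_fst_of_blowup {V : Type*} {G : SimpleGraph V} {m : ℕ}
    {t : Set (V × Fin m)} (ht : (G.blowup m).IsClique t) : Set.InjOn Prod.fst t := by
  intro x hx y hy hxy
  by_contra hne
  have hadj : G.Adj x.1 y.1 := ht hx hy hne
  exact G.loopless.irrefl _ (hxy ▸ hadj)

/-- The projection of a `q`-clique of the blowup is a `q`-clique. -/
theorem SimpleGraph.IsNClique.image_fst_of_blowup {V : Type*} {G : SimpleGraph V} {q m : ℕ}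
    {t : Finset (V × Fin m)} (ht : (G.blowup m).IsNClique q t) :
    G.IsNClique q (t.image Prod.fst) := by
  refine ⟨?_, ?_⟩
  · rw [Finset.coe_image]
    rintro _ ⟨x, hx, rfl⟩ _ ⟨y, hy, rfl⟩ hne
    exact ht.isClique hx hy fun hxy => hne (congrArg Prod.fst hxy)
  · rw [Finset.card_image_of_injOn ht.isClique.injOn_fst_of_blowup, ht.card_eq]

/-- The graph of a function on a `q`-clique is a `q`-clique of the blowup. -/
theorem SimpleGraph.IsNClique.image_blowup {V : Type*} {G : SimpleGraph V} {q m : ℕ}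
    {s : Finset V} (hs : G.IsNClique q s) (f : V → Fin m) :
    (G.blowup m).IsNClique q (s.image fun x => (x, f x)) := by
  refine ⟨?_, ?_⟩
  · rw [Finset.coe_image]
    rintro _ ⟨x, hx, rfl⟩ _ ⟨y, hy, rfl⟩ hne
    exact hs.isClique hx hy fun hxy => hne (by rw [hxy])
  · rw [Finset.card_image_of_injective _ fun x y hxy => congrArg Prod.fst hxy, hs.card_eq]

/-- The number of functions with prescribed values at two distinct points. -/
theorem Fintype.card_filter_apply_eq_and_apply_eq {V α : Type*} [Fintype V] [Fintype α] {u v : V}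
    (huv : u ≠ v) (a b : α) :
    (Finset.univ.filter fun f : V → α => f u = a ∧ f v = b).card * Fintype.card α ^ 2 =
      Fintype.card α ^ Fintype.card V := by
  have hpi : (Finset.univ.filter fun f : V → α => f u = a ∧ f v = b) =
      Fintype.piFinset fun x => if x = u then {a} else if x = v then {b} else Finset.univ := by
    ext f
    simp only [Finset.mem_filter, Finset.mem_univ, true_and, Fintype.mem_piFinset]
    constructor
    · rintro ⟨rfl, rfl⟩ x
      split_ifs with h₁ h₂ <;> simp [*]
    · intro h
      exact ⟨by simpa using h u, by simpa [huv.symm] using h v⟩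
  have hu : (∏ x : V, if x = u then Fintype.card α else 1) = Fintype.card α := by simp
  have hv : (∏ x : V, if x = v then Fintype.card α else 1) = Fintype.card α := by simp
  calc _ = (∏ x : V, (if x = u then {a} else if x = v then {b} else Finset.univ : Finset α).card) *
        ((∏ x : V, if x = u then Fintype.card α else 1) *
          ∏ x : V, if x = v then Fintype.card α else 1) := by
        rw [hpi, Fintype.card_piFinset, hu, hv, sq]
    _ = ∏ _x : V, Fintype.card α := by
        rw [← Finset.prod_mul_distrib, ← Finset.prod_mul_distrib]
        refine Finset.prod_congr rfl fun x _ => ?_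
        by_cases h₁ : x = u
        · simp [h₁, huv]
        · by_cases h₂ : x = v <;> simp [h₁, h₂, huv.symm]
    _ = _ := by simp

/-- Averaging the weights of the cliques of the blowup over their projections. -/
theorem SimpleGraph.HasFractionalDecomposition.of_blowup {V : Type*} [Fintype V]
    {G : SimpleGraph V} {q m : ℕ} (hm : 1 ≤ m)
    (h : (G.blowup m).HasFractionalDecomposition q) : G.HasFractionalDecomposition q := by
  obtain ⟨w, hw, hsum⟩ := h
  refine .of_family (Finset.univ.filter fun t => (G.blowup m).IsNClique q t)
    (fun t => t.image Prod.fst) (fun t => w t / (m : ℝ) ^ 2)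
    (fun t _ => div_nonneg (hw t) (by positivity))
    (fun t ht => (Finset.mem_filter.mp ht).2.image_fst_of_blowup) fun u v huv => ?_
  have hdisj : Set.PairwiseDisjoint ((Finset.univ : Finset (Fin m × Fin m)) : Set (Fin m × Fin m))
      fun p => Finset.univ.filter
        fun t => (G.blowup m).IsNClique q t ∧ (u, p.1) ∈ t ∧ (v, p.2) ∈ t := by
    intro p _ p' _ hne
    refine Finset.disjoint_left.mpr fun t ht ht' => hne ?_
    simp only [Finset.mem_filter, Finset.mem_univ, true_and] at ht ht'
    have hinj := ht.1.isClique.injOn_fst_of_blowup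
    exact Prod.ext (Prod.ext_iff.mp (hinj ht.2.1 ht'.2.1 rfl)).2
      (Prod.ext_iff.mp (hinj ht.2.2 ht'.2.2 rfl)).2
  have hm' : (m : ℝ) ≠ 0 := by positivity
  rw [← Finset.sum_div, div_eq_one_iff_eq (pow_ne_zero 2 hm')]
  trans ∑ t ∈ (Finset.univ : Finset (Fin m × Fin m)).biUnion fun p => Finset.univ.filter
      fun t => (G.blowup m).IsNClique q t ∧ (u, p.1) ∈ t ∧ (v, p.2) ∈ t, w t
  · refine Finset.sum_congr ?_ fun _ _ => rfl
    ext t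
    simp only [Finset.mem_filter, Finset.mem_univ, true_and, Finset.mem_image, Prod.exists,
      Finset.mem_biUnion]
    constructor
    · rintro ⟨ht, ⟨_, i, hi, rfl⟩, ⟨_, j, hj, rfl⟩⟩
      exact ⟨i, j, ht, hi, hj⟩
    · rintro ⟨i, j, ht, hi, hj⟩
      exact ⟨ht, ⟨u, i, hi, rfl⟩, ⟨v, j, hj, rfl⟩⟩
  have hadj (p : Fin m × Fin m) : (G.blowup m).Adj (u, p.1) (v, p.2) := huv
  rw [Finset.sum_biUnion hdisj]
  trans ∑ _p : Fin m × Fin m, (1 : ℝ)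
  · refine Finset.sum_congr rfl fun p _ => ?_
    convert hsum (hadj p)
  simp only [Finset.sum_const, Finset.card_univ, Fintype.card_prod, Fintype.card_fin, nsmul_eq_mul,
    Nat.cast_mul, mul_one, sq]

/-- Spreading the weight of every clique uniformly over its lifts to the blowup. -/
theorem SimpleGraph.HasFractionalDecomposition.blowup {V : Type*} [Fintype V]
    {G : SimpleGraph V} {q m : ℕ} (hm : 1 ≤ m) (h : G.HasFractionalDecomposition q) :
    (G.blowup m).HasFractionalDecomposition q := by
  obtain ⟨w, hw, hsum⟩ := h
  refine .of_family ((Finset.univ.filter fun s => G.IsNClique q s) ×ˢ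
      (Finset.univ : Finset (V → Fin m)))
    (fun p => p.1.image fun x => (x, p.2 x))
    (fun p => w p.1 * ((m : ℝ) ^ 2 / (m : ℝ) ^ Fintype.card V))
    (fun p _ => mul_nonneg (hw _) (by positivity))
    (fun p hp => (Finset.mem_filter.mp (Finset.mem_product.mp hp).1).2.image_blowup p.2) ?_
  rintro ⟨u, i⟩ ⟨v, j⟩ huv
  replace huv : G.Adj u v := huv
  have hmem (s : Finset V) (f : V → Fin m) (x : V) (k : Fin m) :
      (x, k) ∈ (s.image fun y => (y, f y)) ↔ x ∈ s ∧ f x = k := by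
    simp only [Finset.mem_image, Prod.mk.injEq]
    constructor
    · rintro ⟨y, hy, rfl, hk⟩
      exact ⟨hy, hk⟩
    · rintro ⟨hx, hk⟩
      exact ⟨x, hx, rfl, hk⟩
  have hcard := Fintype.card_filter_apply_eq_and_apply_eq huv.ne i j
  rw [Fintype.card_fin] at hcard
  trans ∑ p ∈ (Finset.univ.filter fun s => G.IsNClique q s ∧ u ∈ s ∧ v ∈ s) ×ˢ
      Finset.univ.filter fun f : V → Fin m => f u = i ∧ f v = j,
    w p.1 * ((m : ℝ) ^ 2 / (m : ℝ) ^ Fintype.card V)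
  · refine Finset.sum_congr ?_ fun _ _ => rfl
    ext ⟨s, f⟩
    simp only [Finset.mem_filter, Finset.mem_product, Finset.mem_univ, true_and, and_true, hmem]
    tauto
  rw [Finset.sum_product]
  simp only [Finset.sum_const, nsmul_eq_mul]
  rw [← Finset.mul_sum, ← Finset.sum_mul, hsum huv, one_mul, mul_div_assoc', div_eq_one_iff_eq
    (by positivity)]
  have hcard_real := congrArg (Nat.cast : ℕ → ℝ) hcard
  push_cast at hcard_real
  convert hcard_real

/-- For every integer `q ≥ 2`, every integer `m ≥ 1`, and every finite simple graph `G`,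
the `m`-blowup `G∘K̄_m` admits a fractional `K_q`-decomposition if and only if `G` does. -/
theorem statement5 {V : Type*} [Fintype V] (G : SimpleGraph V) (q m : ℕ)
    (hq : 2 ≤ q) (hm : 1 ≤ m) :
    (G.blowup m).HasFractionalDecomposition q ↔ G.HasFractionalDecomposition q := by
  exact ⟨.of_blowup hm, .blowup hm⟩
end

section
/- There exist a real number c > 1 and a finite simple graph G with minimum degree at least (1 - 1/(c·6))·v(G) such that G admits no fractional K_5-decomposition. -/
open scoped Classical

/-- Farkas-type obstruction: in a graph with a fractional `K_q`-decomposition, an edge weighting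
that is non-negative on every `q`-clique has non-negative total weight. -/
theorem SimpleGraph.HasFractionalDecomposition.sum_weight_nonneg {V : Type*} [Fintype V]
    {G : SimpleGraph V} {q : ℕ} (h : G.HasFractionalDecomposition q) (φ : V → V → ℝ)
    (hφ : ∀ s : Finset V, G.IsNClique q s →
      0 ≤ ∑ u ∈ s, ∑ v ∈ s, if G.Adj u v then φ u v else 0) :
    0 ≤ ∑ u, ∑ v, if G.Adj u v then φ u v else 0 := by
  obtain ⟨w, hw, hsum⟩ := h
  have key : ∑ u, ∑ v, (if G.Adj u v then φ u v else 0) =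
      ∑ s ∈ Finset.univ.filter (fun s : Finset V => G.IsNClique q s),
        w s * ∑ u ∈ s, ∑ v ∈ s, if G.Adj u v then φ u v else 0 := by
    calc
      _ = ∑ u, ∑ v, ∑ s ∈ Finset.univ.filter (fun s : Finset V => G.IsNClique q s),
          if u ∈ s ∧ v ∈ s then w s * (if G.Adj u v then φ u v else 0) else 0 := by
        refine Finset.sum_congr rfl fun u _ => Finset.sum_congr rfl fun v _ => ?_
        by_cases huv : G.Adj u v
        · rw [← Finset.sum_filter, Finset.filter_filter, ← Finset.sum_mul, hsum huv, one_mul]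
        · simp [huv]
      _ = ∑ s ∈ Finset.univ.filter (fun s : Finset V => G.IsNClique q s), ∑ u, ∑ v,
          if u ∈ s ∧ v ∈ s then w s * (if G.Adj u v then φ u v else 0) else 0 := by
        rw [Finset.sum_comm]
        simp_rw [Finset.sum_comm (s := (Finset.univ : Finset V))
          (t := Finset.univ.filter (fun s : Finset V => G.IsNClique q s))]
        exact Finset.sum_congr rfl fun s _ => Finset.sum_comm
      _ = _ := by
        refine Finset.sum_congr rfl fun s _ => ?_
        simp only [ite_and, Finset.sum_ite_irrel, Finset.sum_const_zero, Finset.sum_ite_mem,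
          Finset.univ_inter, Finset.mul_sum]
  rw [key]
  refine Finset.sum_nonneg fun s hs => mul_nonneg (hw s) (hφ s ?_)
  simpa using hs

/-- The join of the complements of the squares of the cycles `C_9` (on the vertices below `9`)
and `C_22` (on the other vertices). -/
def joinOfCirculants : SimpleGraph (Fin 31) where
  Adj u v := ¬ ((u.val < 9 ↔ v.val < 9) ∧
    Nat.dist u v ∈ if u.val < 9 then [0, 1, 2, 7, 8] else [0, 1, 2, 20, 21])
  symm := ⟨fun u v h => by
    contrapose! h
    obtain ⟨h₁, h₂⟩ := h
    rw [Nat.dist_comm] at h₂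
    simp only [h₁] at h₂ ⊢
    exact ⟨trivial, h₂⟩⟩
  loopless := ⟨fun u h => h ⟨Iff.rfl, by rw [Nat.dist_self]; split_ifs <;> simp⟩⟩

instance : DecidableRel joinOfCirculants.Adj := fun u v =>
  inferInstanceAs (Decidable (¬ ((u.val < 9 ↔ v.val < 9) ∧
    Nat.dist u v ∈ if u.val < 9 then [0, 1, 2, 7, 8] else [0, 1, 2, 20, 21])))

theorem degree_joinOfCirculants (v : Fin 31) : joinOfCirculants.degree v = 26 := by
  revert v
  decide +kernel

/-- The weight `12` on pairs inside the first part, `-3` on pairs between the parts and `2` on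
pairs inside the second part. -/
def circulantWeight (u v : Fin 31) : ℤ :=
  if u.val < 9 then if v.val < 9 then 12 else -3 else if v.val < 9 then -3 else 2

theorem sum_circulantWeight :
    ∑ u, ∑ v, (if joinOfCirculants.Adj u v then circulantWeight u v else 0) = -8 := by
  decide +kernel

theorem sum_circulantWeight_nonneg {s : Finset (Fin 31)} (hs : joinOfCirculants.IsNClique 5 s) :
    0 ≤ ∑ u ∈ s, ∑ v ∈ s, if joinOfCirculants.Adj u v then circulantWeight u v else 0 := by
  have hcard := hs.card_eq
  set x : Fin 31 → ℤ := fun u => if u.val < 9 then 1 else 0 with hx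
  set a : ℤ := ∑ u ∈ s, x u with ha
  have hpair : ∀ u ∈ s, ∀ v ∈ s,
      (if joinOfCirculants.Adj u v then circulantWeight u v else 0) =
        2 - 5 * x u - 5 * x v + 20 * (x u * x v) - if u = v then 10 * x u + 2 else 0 := by
    intro u hu v hv
    by_cases huv : u = v
    · subst huv
      by_cases h : u.val < 9 <;> simp [hx, h]
    · rw [if_pos (hs.isClique hu hv huv)]
      by_cases h : u.val < 9 <;> by_cases h' : v.val < 9 <;>
        simp [hx, h, h', huv, circulantWeight]
  have hsum : ∑ u ∈ s, ∑ v ∈ s, (if joinOfCirculants.Adj u v then circulantWeight u v else 0) =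
      20 * ((a - 1) * (a - 2)) := by
    rw [Finset.sum_congr rfl fun u hu => Finset.sum_congr rfl (hpair u hu)]
    have hdiag : ∑ u ∈ s, ∑ v ∈ s, (if u = v then 10 * x u + 2 else 0) = 10 * a + 10 := by
      simp only [Finset.sum_ite_eq, Finset.sum_ite_mem, Finset.inter_self, Finset.sum_add_distrib,
        ← Finset.mul_sum, Finset.sum_const, hcard, ← ha]
      norm_num
    simp only [Finset.sum_sub_distrib, Finset.sum_add_distrib, hdiag, ← Finset.mul_sum,
      Finset.sum_const, hcard, ← Finset.sum_mul, ← ha, nsmul_eq_mul]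
    push_cast
    ring
  rw [hsum]
  rcases le_or_gt a 1 with h | h
  · nlinarith
  · nlinarith [show 2 ≤ a from h]

/-- There exist a real `c > 1` and a finite simple graph `G` with minimum degree at least
`(1 - 1/(c·6))·v(G)` admitting no fractional `K_5`-decomposition. -/
theorem statement10 :
    ∃ (c : ℝ) (n : ℕ) (G : SimpleGraph (Fin n)), 1 < c ∧
      (1 - 1 / (c * 6)) * n ≤ (G.minDegree : ℝ) ∧
      ¬ G.HasFractionalDecomposition 5 := by
  refine ⟨31 / 30, 31, joinOfCirculants, by norm_num, ?_, fun h => ?_⟩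
  · have hdeg : 26 ≤ joinOfCirculants.minDegree :=
      SimpleGraph.le_minDegree_of_forall_le_degree _ _ fun v => by
        convert (degree_joinOfCirculants v).ge
    have hdeg' : (26 : ℝ) ≤ joinOfCirculants.minDegree := by exact_mod_cast hdeg
    convert hdeg' using 1
    · norm_num
    · congr!
  · have := h.sum_weight_nonneg (fun u v => (circulantWeight u v : ℝ)) fun s hs => by
      have := sum_circulantWeight_nonneg hs
      rify at this
      convert this
      split_ifs <;> simp
    have htotal := sum_circulantWeight
    rify at htotal
    have hneg : (0 : ℝ) ≤ -8 := by
      rw [← htotal]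
      convert this
      split_ifs <;> simp
    norm_num at hneg
end
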